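/- Let β ∈ (0,1), let d ≥ 2 and J be natural numbers with 2^J ≥ d, and let φ : ℝ → ℝ be continuously differentiable with support contained in [0,d] and symmetric about d/2, i.e., φ(d/2 − x) = φ(d/2 + x) for all x. Let θ : ℝ → ℝ be continuously differentiable with support contained in [0, d_θ] for some real d_θ with 0 < d_θ < d. Set θ_J(x) := 2^{J/2} θ(2^J x) and θ̃_J(x) := 2^{J/2} θ(2^J (1−x)). Then for every integer k with 0 ≤ k ≤ 2^J − d, B_β(φ_{J,k}, θ_J) = B_β(θ̃_J, φ_{J, 2^J − d − k}). -/

import Mathlib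

open MeasureTheory intervalIntegral

/-- The fractional stiffness pairing
`B_β(u,v) = (1/Γ(β)) ∫₀¹ (∫₀ˣ (x−s)^{β−1} u′(s) ds) v′(x) dx`. -/
noncomputable def Bfrac (β : ℝ) (u v : ℝ → ℝ) : ℝ :=
  (1 / Real.Gamma β) *
    ∫ x in (0:ℝ)..1, (∫ s in (0:ℝ)..x, (x - s) ^ (β - 1) * deriv u s) * deriv v x

/-- `φ_{J,k}(x) = 2^{J/2} φ(2^J x − k)`. -/
noncomputable def scaleFn (φ : ℝ → ℝ) (J : ℕ) (k : ℤ) : ℝ → ℝ :=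
  fun x => (2:ℝ) ^ ((J : ℝ) / 2) * φ ((2:ℝ) ^ J * x - (k : ℝ))

/-- Dirichlet's formula: the triangle `0 < s ≤ x ≤ 1` may be integrated in either order against
the weakly singular kernel `(x - s) ^ (β - 1)`. -/
theorem integral_rpow_kernel_swap {β : ℝ} (hβ : 0 < β) {f g : ℝ → ℝ}
    (hf : Continuous f) (hg : Continuous g) :
    ∫ x in (0:ℝ)..1, (∫ s in (0:ℝ)..x, (x - s) ^ (β - 1) * f s) * g x
      = ∫ s in (0:ℝ)..1, (∫ x in s..1, (x - s) ^ (β - 1) * g x) * f s := by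
  set U : ℝ → ℝ := (Set.Ioc (0:ℝ) 1).indicator f with hU
  set V : ℝ → ℝ := (Set.Ioc (0:ℝ) 1).indicator g with hV
  set K : ℝ → ℝ := (Set.Icc (0:ℝ) 1).indicator (fun t => t ^ (β - 1)) with hK
  have hUi : Integrable U :=
    (integrable_indicator_iff measurableSet_Ioc).2
      ((hf.continuousOn.integrableOn_Icc).mono_set Set.Ioc_subset_Icc_self)
  have hKi : Integrable K := by
    refine (integrable_indicator_iff measurableSet_Icc).2 ?_
    rw [integrableOn_Icc_iff_integrableOn_Ioc,
      ← intervalIntegrable_iff_integrableOn_Ioc_of_le zero_le_one]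
    exact intervalIntegrable_rpow' (by linarith)
  obtain ⟨C, hC⟩ := isCompact_Icc.exists_bound_of_continuousOn
    (hg.continuousOn (s := Set.Icc (0:ℝ) 1))
  have hC0 : 0 ≤ C := (norm_nonneg _).trans (hC 0 (by simp))
  have hVb : ∀ x, ‖V x‖ ≤ C := by
    intro x
    by_cases hx : x ∈ Set.Ioc (0:ℝ) 1
    · simpa [hV, hx] using hC x (Set.Ioc_subset_Icc_self hx)
    · rw [hV, Set.indicator_of_notMem hx]
      simpa using hC0
  have hVm : Measurable V := hg.measurable.indicator measurableSet_Ioc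
  have hF : Integrable (fun p : ℝ × ℝ => V p.1 * (U p.2 * K (p.1 - p.2)))
      (volume.prod volume) :=
    (hUi.convolution_integrand (ContinuousLinearMap.mul ℝ ℝ) hKi).bdd_mul
      (c := C) (hVm.comp measurable_fst).aestronglyMeasurable
      (Filter.Eventually.of_forall fun p => hVb p.1)
  have key := integral_integral_swap (f := fun x s => V x * (U s * K (x - s))) hF
  have h1 : ∫ x, ∫ s, V x * (U s * K (x - s))
      = ∫ x in (0:ℝ)..1, (∫ s in (0:ℝ)..x, (x - s) ^ (β - 1) * f s) * g x := by
    rw [integral_of_le zero_le_one, ← MeasureTheory.integral_indicator measurableSet_Ioc]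
    congr 1 with x
    by_cases hx : x ∈ Set.Ioc (0:ℝ) 1
    · rw [Set.indicator_of_mem hx, MeasureTheory.integral_const_mul, mul_comm]
      simp only [hV, Set.indicator_of_mem hx]
      rw [integral_of_le hx.1.le, ← MeasureTheory.integral_indicator measurableSet_Ioc]
      congr 2 with s
      obtain ⟨hx0, hx1⟩ := hx
      simp only [hU, hK, Set.indicator_apply, Set.mem_Ioc, Set.mem_Icc]
      split_ifs <;> grind
    · simp [hV, Set.indicator_of_notMem hx]
  have h2 : ∫ s, ∫ x, V x * (U s * K (x - s))
      = ∫ s in (0:ℝ)..1, (∫ x in s..1, (x - s) ^ (β - 1) * g x) * f s := by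
    rw [integral_of_le zero_le_one, ← MeasureTheory.integral_indicator measurableSet_Ioc]
    congr 1 with s
    by_cases hs : s ∈ Set.Ioc (0:ℝ) 1
    · rw [Set.indicator_of_mem hs]
      simp only [hU, Set.indicator_of_mem hs]
      rw [integral_of_le hs.2, ← integral_Icc_eq_integral_Ioc,
        ← MeasureTheory.integral_indicator measurableSet_Icc,
        ← MeasureTheory.integral_mul_const]
      congr 1 with x
      obtain ⟨hs0, hs1⟩ := hs
      simp only [hV, hK, Set.indicator_apply, Set.mem_Ioc, Set.mem_Icc]
      split_ifs <;> grind
    · simp [hU, Set.indicator_of_notMem hs]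
  rw [← h1, ← h2, key]

/-- Reflecting `[0, 1]` exchanges the two arguments of the fractional stiffness pairing. -/
theorem Bfrac_reflect {β : ℝ} (hβ : 0 < β) {u v : ℝ → ℝ}
    (hu : ContDiff ℝ 1 u) (hv : ContDiff ℝ 1 v) :
    Bfrac β u v = Bfrac β (fun x => v (1 - x)) (fun x => u (1 - x)) := by
  unfold Bfrac
  congr 1
  rw [integral_rpow_kernel_swap hβ (hu.continuous_deriv le_rfl) (hv.continuous_deriv le_rfl)]
  simp only [deriv_comp_const_sub]
  have hinner (x : ℝ) : ∫ s in (0:ℝ)..x, (x - s) ^ (β - 1) * -deriv v (1 - s)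
      = -∫ t in (1 - x)..1, (t - (1 - x)) ^ (β - 1) * deriv v t := by
    have h := integral_comp_sub_left (a := 0) (b := x)
      (fun t => (t - (1 - x)) ^ (β - 1) * deriv v t) 1
    rw [sub_zero] at h
    rw [← h, ← intervalIntegral.integral_neg]
    congr 1 with s
    rw [show 1 - s - (1 - x) = x - s by ring, mul_neg]
  simp only [hinner, neg_mul_neg]
  have h := integral_comp_sub_left (a := 0) (b := 1)
    (fun y => (∫ t in y..1, (t - y) ^ (β - 1) * deriv v t) * deriv u y) 1
  rw [sub_zero, sub_self] at h
  exact h.symm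

theorem stmt_4 (β : ℝ) (hβ : β ∈ Set.Ioo (0:ℝ) 1) (d J : ℕ) (hd : 2 ≤ d)
    (hJd : d ≤ 2 ^ J) (φ : ℝ → ℝ) (hφ : ContDiff ℝ 1 φ)
    (hsupp : Function.support φ ⊆ Set.Icc (0:ℝ) (d : ℝ))
    (hsym : ∀ x : ℝ, φ ((d : ℝ) / 2 - x) = φ ((d : ℝ) / 2 + x))
    (θ : ℝ → ℝ) (hθ : ContDiff ℝ 1 θ) (dθ : ℝ) (hdθ0 : 0 < dθ) (hdθd : dθ < (d : ℝ))
    (hθsupp : Function.support θ ⊆ Set.Icc (0:ℝ) dθ)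
    (k : ℤ) (hk0 : 0 ≤ k) (hk1 : k ≤ 2 ^ J - (d : ℤ)) :
    Bfrac β (scaleFn φ J k) (fun x => (2:ℝ) ^ ((J : ℝ) / 2) * θ ((2:ℝ) ^ J * x))
      = Bfrac β (fun x => (2:ℝ) ^ ((J : ℝ) / 2) * θ ((2:ℝ) ^ J * (1 - x)))
          (scaleFn φ J (2 ^ J - (d : ℤ) - k)) := by
  have hu : ContDiff ℝ 1 (scaleFn φ J k) := by
    unfold scaleFn
    fun_prop
  rw [Bfrac_reflect hβ.1 hu (by fun_prop)]
  congr 1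
  ext x
  simp only [scaleFn]
  have h := hsym ((d : ℝ) / 2 - ((2:ℝ) ^ J * (1 - x) - k))
  rw [sub_sub_cancel] at h
  rw [h]
  push_cast
  congr 2
  ring
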